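/- arXiv:2108.04850 — 2 statements merged into one kernel-verified Lean document; each statement's English description precedes it below -/
import Mathlib

section
/- For all integers m, n ≥ 3 and ℓ ≥ 0, the kayak paddle graph KP_{m,ℓ−1,n} = C_m + P_{ℓ+1} + C_n — the labelled graph obtained by concatenating the cycle C_m, the path P_{ℓ+1} on ℓ+1 vertices, and the cycle C_n — is e-positive. -/
open scoped Classical
noncomputable section

/-- Words of length `d` in the positive integers. -/
abbrev NCWord (d : ℕ) := Fin d → ℕ+

/-- `M_d`: coefficient functions of homogeneous degree-`d` series in
noncommuting variables. -/
abbrev Md (d : ℕ) := NCWord d → ℚ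

/-- `Y_G`, the chromatic symmetric function of a labelled graph in
noncommuting variables, as an element of `M_d`. -/
def YG {d : ℕ} (G : SimpleGraph (Fin d)) : Md d :=
  fun w => if ∀ j k : Fin d, G.Adj j k → w j ≠ w k then 1 else 0

/-- Set partitions of `{0, …, d-1}`. -/
abbrev SetPtn (d : ℕ) := Finpartition (Finset.univ : Finset (Fin d))

/-- `j` and `k` lie in a common block of `π`. -/
def sameBlock {d : ℕ} (π : SetPtn d) (j k : Fin d) : Prop :=
  ∃ B ∈ π.parts, j ∈ B ∧ k ∈ B

/-- The elementary symmetric function `e_π` in noncommuting variables. -/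
def eSP {d : ℕ} (π : SetPtn d) : Md d :=
  fun w => if ∀ j k : Fin d, j ≠ k → sameBlock π j k → w j ≠ w k then 1 else 0

/-- The block of `π` containing `a`. -/
def blockOf {d : ℕ} (π : SetPtn d) (a : Fin d) : Finset (Fin d) :=
  Finset.univ.filter fun k => sameBlock π a k

/-- The type of a set partition relative to the distinguished element `a`:
the multiset of sizes of the blocks not containing `a` (an integer partition),
together with the size of the block containing `a`. -/
def ptype {d : ℕ} (π : SetPtn d) (a : Fin d) : Multiset ℕ × ℕ :=
  ((π.parts.erase (blockOf π a)).val.map Finset.card, (blockOf π a).card)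

/-- `K_d`: the span of the differences `e_{π₁} - e_{π₂}` over pairs of set
partitions of equal type (relative to the distinguished element `a`). -/
def Ksub {d : ℕ} (a : Fin d) : Submodule ℚ (Md d) :=
  Submodule.span ℚ
    {f | ∃ π₁ π₂ : SetPtn d, ptype π₁ a = ptype π₂ a ∧ f = eSP π₁ - eSP π₂}

/-- `(e)`-positivity of a labelled graph, with distinguished vertex `a`:
`Y_G` is congruent modulo `K_d` to a nonnegative combination of `e_π`'s. -/
def IsEPosNCAt {d : ℕ} (G : SimpleGraph (Fin d)) (a : Fin d) : Prop :=
  ∃ (s : Finset (SetPtn d)) (c : SetPtn d → ℚ),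
    (∀ π, 0 ≤ c π) ∧ YG G - ∑ π ∈ s, c π • eSP π ∈ Ksub a

/-- Induction `↑ : M_d → M_{d+1}`. -/
def induct {d : ℕ} (f : Md d) : Md (d + 1) :=
  fun w => if w (Fin.last d) = w ⟨d - 1, by omega⟩
    then f (fun t => w t.castSucc) else 0

/-- Concatenation of labelled graphs: identify the last vertex of `G` with
the first vertex of `H`. -/
def concatG {p q : ℕ} (G : SimpleGraph (Fin p)) (H : SimpleGraph (Fin q)) :
    SimpleGraph (Fin (p + q - 1)) :=
  SimpleGraph.fromRel fun a b =>
    (∃ i j : Fin p, G.Adj i j ∧ (a : ℕ) = (i : ℕ) ∧ (b : ℕ) = (j : ℕ)) ∨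
    (∃ i j : Fin q, H.Adj i j ∧ (a : ℕ) = (i : ℕ) + (p - 1) ∧ (b : ℕ) = (j : ℕ) + (p - 1))

/-- The reverse graph `G^r`. -/
def revG {d : ℕ} (G : SimpleGraph (Fin d)) : SimpleGraph (Fin d) :=
  SimpleGraph.comap (fun i : Fin d => (⟨d - 1 - (i : ℕ), by have := i.isLt; omega⟩ : Fin d)) G

/-- A labelled graph: a simple graph on vertex set `{0, …, n-1}`, `n ≥ 1`. -/
structure LGraph where
  n : ℕ
  npos : 0 < n
  G : SimpleGraph (Fin n)

/-- The last vertex of a labelled graph. -/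
def LGraph.last (A : LGraph) : Fin A.n := ⟨A.n - 1, by have := A.npos; omega⟩

/-- A labelled graph is `(e)`-positive (at its last vertex). -/
def LGraph.EPosNC (A : LGraph) : Prop := IsEPosNCAt A.G A.last

/-- Concatenation, as an operation on labelled graphs. -/
def LGraph.concat (A B : LGraph) : LGraph :=
  ⟨A.n + B.n - 1, by have := A.npos; have := B.npos; omega, concatG A.G B.G⟩

/-- Reversal, as an operation on labelled graphs. -/
def LGraph.rev (A : LGraph) : LGraph := ⟨A.n, A.npos, revG A.G⟩

/-- Appendable `(e)`-positivity: `G + H` is `(e)`-positive for every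
`(e)`-positive labelled graph `G`. -/
def LGraph.Appendable (H : LGraph) : Prop :=
  ∀ A : LGraph, A.EPosNC → (A.concat H).EPosNC

/-- The chromatic symmetric polynomial of `G` in `n` commuting variables. -/
def cspoly {V : Type} [Fintype V] [DecidableEq V] (G : SimpleGraph V) (n : ℕ) :
    MvPolynomial (Fin n) ℚ :=
  ∑ κ ∈ Finset.univ.filter (fun κ : V → Fin n => ∀ u v : V, G.Adj u v → κ u ≠ κ v),
    ∏ v : V, MvPolynomial.X (κ v)

/-- `e`-positivity of a finite graph. -/
def EPos {V : Type} [Fintype V] [DecidableEq V] (G : SimpleGraph V) : Prop :=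
  ∃ c : Nat.Partition (Fintype.card V) → ℚ, (∀ p, 0 ≤ c p) ∧
    ∀ n : ℕ, cspoly G n =
      ∑ p : Nat.Partition (Fintype.card V),
        c p • (p.parts.map fun r => MvPolynomial.esymm (Fin n) ℚ r).prod

/-- Closed neighbourhood of a vertex, as a finset. -/
def closedNbhd {d : ℕ} (G : SimpleGraph (Fin d)) (i : Fin d) : Finset (Fin d) :=
  Finset.univ.filter fun k => k = i ∨ G.Adj i k

/-- `m_i`: the largest label in the closed neighbourhood of `i`. -/
def mIdx {d : ℕ} (G : SimpleGraph (Fin d)) (i : Fin d) : Fin d :=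
  (closedNbhd G i).max' ⟨i, by simp [closedNbhd]⟩

/-- `w_i`: the smallest label in the closed neighbourhood of `i`. -/
def wIdx {d : ℕ} (G : SimpleGraph (Fin d)) (i : Fin d) : Fin d :=
  (closedNbhd G i).min' ⟨i, by simp [closedNbhd]⟩

/-- Labelled unit interval graph. -/
def IsUnitInterval {d : ℕ} (G : SimpleGraph (Fin d)) : Prop :=
  ∀ i v w j : Fin d, i ≤ v → v < w → w ≤ j → G.Adj i j → G.Adj v w

/-- An acyclic orientation of a graph, as an asymmetric relation with
irreflexive transitive closure whose symmetrization matches adjacency. -/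
def IsAcyclicOrientation {V : Type} (G : SimpleGraph V) (r : V → V → Prop) : Prop :=
  (∀ a b, r a b → ¬ r b a) ∧
  (∀ a b, a ≠ b → ((r a b ∨ r b a) ↔ G.Adj a b)) ∧
  Irreflexive (Relation.TransGen r)

/-- The set of sinks of an orientation. -/
def sinkSet {V : Type} [Fintype V] (r : V → V → Prop) : Finset V :=
  Finset.univ.filter fun x => ∀ y, ¬ r x y

/-- The labelled path `P_d`. -/
def PathG (d : ℕ) : SimpleGraph (Fin d) :=
  SimpleGraph.fromRel fun a b => (b : ℕ) = (a : ℕ) + 1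

/-- The labelled cycle `C_d`. -/
def CycleG (d : ℕ) : SimpleGraph (Fin d) :=
  SimpleGraph.fromRel fun a b => (b : ℕ) = (a : ℕ) + 1 ∨ ((a : ℕ) = 0 ∧ (b : ℕ) = d - 1)

open MvPolynomial

/-! ### Polynomials attached to a colour -/

/-- The degree-`k` elementary symmetric polynomial in the variables other than `X c`, defined by the
recursion `e_{k+1} = q_{k+1} + X c * q_k`. -/
def esymmAvoid {n : ℕ} : ℕ → Fin n → MvPolynomial (Fin n) ℚ
  | 0, _ => 1
  | k + 1, c => esymm (Fin n) ℚ (k + 1) - X c * esymmAvoid k c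

/-- One step of a properly coloured walk: `f` is summed over all colours other than the given one,
weighted by their variables. -/
def walkStep {n : ℕ} (f : Fin n → MvPolynomial (Fin n) ℚ) (c : Fin n) : MvPolynomial (Fin n) ℚ :=
  ∑ d, X d * f d - X c * f c

/-- Properly coloured paths with `k` edges starting at a vertex of colour `c`, the variable of the
starting vertex being omitted. -/
def pathPoly {n : ℕ} (k : ℕ) : Fin n → MvPolynomial (Fin n) ℚ :=
  walkStep^[k] 1

/-- Properly coloured cycles on `k + 1` vertices through a vertex of colour `c`, whose variable is
omitted. -/
def cyclePoly {n : ℕ} (k : ℕ) (c : Fin n) : MvPolynomial (Fin n) ℚ :=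
  walkStep^[k] (fun d => if d = c then 0 else 1) c

section Identities

variable {n : ℕ}

lemma walkStep_add (f g : Fin n → MvPolynomial (Fin n) ℚ) :
    walkStep (f + g) = walkStep f + walkStep g := by
  ext1 c
  simp only [walkStep, Pi.add_apply, mul_add, Finset.sum_add_distrib]
  ring

lemma walkStep_mul (a : MvPolynomial (Fin n) ℚ) (f : Fin n → MvPolynomial (Fin n) ℚ) :
    walkStep (fun c => a * f c) = fun c => a * walkStep f c := by
  ext1 c
  simp only [walkStep, mul_sub, Finset.mul_sum, mul_left_comm]

/-- `walkStep` as a linear map over the polynomial ring. -/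
def walkStepLin (n : ℕ) : Module.End (MvPolynomial (Fin n) ℚ) (Fin n → MvPolynomial (Fin n) ℚ) where
  toFun := walkStep
  map_add' := walkStep_add
  map_smul' a f := walkStep_mul a f

lemma walkStepLin_pow (k : ℕ) (f : Fin n → MvPolynomial (Fin n) ℚ) :
    (walkStepLin n ^ k) f = walkStep^[k] f := by
  rw [Module.End.pow_apply]
  rfl

lemma esymmAvoid_succ (k : ℕ) (c : Fin n) :
    esymmAvoid (k + 1) c = esymm (Fin n) ℚ (k + 1) - X c * esymmAvoid k c := rfl

lemma esymmAvoid_eq_sum (k : ℕ) (c : Fin n) :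
    esymmAvoid k c = ∑ i ∈ Finset.range (k + 1), esymm (Fin n) ℚ i * (-X c) ^ (k - i) := by
  induction k with
  | zero => simp [esymmAvoid]
  | succ k ih =>
    rw [esymmAvoid_succ, Finset.sum_range_succ, ih, Finset.mul_sum, sub_eq_add_neg, add_comm,
      ← Finset.sum_neg_distrib]
    congr 1
    · refine Finset.sum_congr rfl fun i hi => ?_
      rw [Nat.succ_sub (Finset.mem_range_succ_iff.mp hi), pow_succ]
      ring
    · simp

lemma sum_X_mul_esymmAvoid (k : ℕ) :
    ∑ c : Fin n, X c * esymmAvoid k c = ((k + 1 : ℕ) : MvPolynomial (Fin n) ℚ) *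
      esymm (Fin n) ℚ (k + 1) := by
  rw [mul_esymm_eq_sum, Finset.sum_filter, Finset.Nat.sum_antidiagonal_eq_sum_range_succ_mk,
    Finset.sum_range_succ]
  simp only [esymmAvoid_eq_sum, lt_irrefl, if_false, add_zero, Finset.mul_sum]
  rw [Finset.sum_comm]
  refine Finset.sum_congr rfl fun i hi => ?_
  have hi' := Finset.mem_range_succ_iff.mp hi
  rw [if_pos (by omega), psum, Finset.mul_sum, Finset.mul_sum]
  refine Finset.sum_congr rfl fun c _ => ?_
  obtain ⟨j, rfl⟩ := Nat.exists_eq_add_of_le hi'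
  rw [show i + j - i = j by omega, show i + j + 1 - i = j + 1 by omega, neg_pow,
    show i + j + 1 + 1 = i + j + 2 by omega, pow_add, pow_add]
  have : ((-1 : MvPolynomial (Fin n) ℚ) ^ i) * (-1) ^ i = 1 := by
    rw [← mul_pow]; simp
  linear_combination (-(-1) ^ j * esymm (Fin n) ℚ i * X c ^ (j + 1)) * this

lemma walkStep_esymmAvoid (k : ℕ) :
    walkStep (esymmAvoid k) = fun c : Fin n =>
      (k : MvPolynomial (Fin n) ℚ) * esymm (Fin n) ℚ (k + 1) + esymmAvoid (k + 1) c := by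
  ext1 c
  rw [walkStep, sum_X_mul_esymmAvoid, esymmAvoid_succ]
  push_cast
  ring

lemma walkStep_sum {ι : Type*} (s : Finset ι) (f : ι → Fin n → MvPolynomial (Fin n) ℚ) :
    walkStep (∑ i ∈ s, f i) = ∑ i ∈ s, walkStep (f i) :=
  map_sum (walkStepLin n) f s

lemma pathPoly_succ (k : ℕ) : pathPoly (n := n) (k + 1) = walkStep (pathPoly k) :=
  Function.iterate_succ_apply' _ _ _

lemma pathPoly_eq (k : ℕ) (c : Fin n) :
    pathPoly k c = esymmAvoid k c + ∑ i ∈ Finset.range k,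
      (i : MvPolynomial (Fin n) ℚ) * esymm (Fin n) ℚ (i + 1) * pathPoly (k - (i + 1)) c := by
  induction k generalizing c with
  | zero => simp [pathPoly, esymmAvoid]
  | succ k ih =>
    have h : pathPoly (n := n) k = esymmAvoid k + ∑ i ∈ Finset.range k, fun c =>
        ((i : MvPolynomial (Fin n) ℚ) * esymm (Fin n) ℚ (i + 1)) * pathPoly (k - (i + 1)) c := by
      ext1 c
      rw [ih c]
      simp
    rw [pathPoly_succ, h, walkStep_add, walkStep_sum, walkStep_esymmAvoid, Finset.sum_range_succ]
    simp only [walkStep_mul, Pi.add_apply, Finset.sum_apply, ← pathPoly_succ]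
    have h0 : pathPoly (n := n) (k + 1 - (k + 1)) c = 1 := by simp [pathPoly]
    rw [h0]
    have h1 : ∀ i ∈ Finset.range k, (i : MvPolynomial (Fin n) ℚ) * esymm (Fin n) ℚ (i + 1) *
        pathPoly (k - (i + 1) + 1) c = (i : MvPolynomial (Fin n) ℚ) * esymm (Fin n) ℚ (i + 1) *
        pathPoly (k + 1 - (i + 1)) c := by
      intro i hi
      have := Finset.mem_range.mp hi
      rw [show k - (i + 1) + 1 = k + 1 - (i + 1) by omega]
    rw [Finset.sum_congr rfl h1]
    ring

lemma cyclePoly_zero (c : Fin n) : cyclePoly 0 c = 0 := by simp [cyclePoly]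

lemma cyclePoly_succ (k : ℕ) (c : Fin n) :
    cyclePoly (k + 1) c = pathPoly (k + 1) c - X c * cyclePoly k c := by
  let δ : Fin n → MvPolynomial (Fin n) ℚ := fun d => if d = c then 0 else 1
  let δ' : Fin n → MvPolynomial (Fin n) ℚ := fun d => if d = c then 1 else 0
  have h1 : δ = 1 - δ' := by
    ext1 d
    simp only [δ, δ', Pi.sub_apply, Pi.one_apply]
    split_ifs <;> simp
  have h2 : walkStep δ' = (X c : MvPolynomial (Fin n) ℚ) • δ := by
    ext1 d
    by_cases h : d = c <;> simp [walkStep, δ, δ', h]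
  have h3 : (walkStepLin n ^ (k + 1)) δ = (walkStepLin n ^ (k + 1)) 1
      - (X c : MvPolynomial (Fin n) ℚ) • (walkStepLin n ^ k) δ := by
    nth_rewrite 1 [h1]
    rw [map_sub, pow_succ, Module.End.mul_apply _ _ δ', ← map_smul, ← h2]
    rfl
  simp only [walkStepLin_pow] at h3
  exact congrFun h3 c

lemma cyclePoly_eq (k : ℕ) (c : Fin n) :
    cyclePoly k c = (k : MvPolynomial (Fin n) ℚ) * esymmAvoid k c + ∑ i ∈ Finset.range k,
      (i : MvPolynomial (Fin n) ℚ) * esymm (Fin n) ℚ (i + 1) * cyclePoly (k - (i + 1)) c := by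
  induction k with
  | zero => simp [cyclePoly_zero]
  | succ k ih =>
    have h1 : ∀ i ∈ Finset.range k, (i : MvPolynomial (Fin n) ℚ) * esymm (Fin n) ℚ (i + 1) *
        cyclePoly (k + 1 - (i + 1)) c = (i : MvPolynomial (Fin n) ℚ) * esymm (Fin n) ℚ (i + 1) *
        pathPoly (k + 1 - (i + 1)) c - X c * ((i : MvPolynomial (Fin n) ℚ) *
        esymm (Fin n) ℚ (i + 1) * cyclePoly (k - (i + 1)) c) := by
      intro i hi
      have := Finset.mem_range.mp hi
      rw [show k + 1 - (i + 1) = k - (i + 1) + 1 by omega, cyclePoly_succ]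
      ring
    rw [Finset.sum_range_succ, Finset.sum_congr rfl h1, Finset.sum_sub_distrib, ← Finset.mul_sum,
      Nat.sub_self, cyclePoly_zero, cyclePoly_succ]
    have hp := pathPoly_eq (k + 1) c
    have h0 : pathPoly (n := n) 0 c = 1 := rfl
    rw [Finset.sum_range_succ, Nat.sub_self, h0] at hp
    have hq := esymmAvoid_succ k c
    simp only [Nat.add_sub_add_right] at hp ⊢
    push_cast
    linear_combination hp - X c * ih - (k : MvPolynomial (Fin n) ℚ) * hq

/-- Moving one unit of degree between the two factors of the pairing. -/
lemma sum_X_mul_esymmAvoid_mul_succ (j k : ℕ) :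
    ∑ c : Fin n, X c * esymmAvoid (j + 1) c * esymmAvoid k c =
      ∑ c : Fin n, X c * esymmAvoid j c * esymmAvoid (k + 1) c +
        ((k : MvPolynomial (Fin n) ℚ) - j) *
          (esymm (Fin n) ℚ (j + 1) * esymm (Fin n) ℚ (k + 1)) := by
  have h : ∀ c : Fin n, X c * esymmAvoid (j + 1) c * esymmAvoid k c =
      X c * esymmAvoid j c * esymmAvoid (k + 1) c + (esymm (Fin n) ℚ (j + 1) *
        (X c * esymmAvoid k c) - esymm (Fin n) ℚ (k + 1) * (X c * esymmAvoid j c)) := by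
    intro c
    simp only [esymmAvoid_succ]
    ring
  rw [Finset.sum_congr rfl fun c _ => h c, Finset.sum_add_distrib, Finset.sum_sub_distrib,
    ← Finset.mul_sum, ← Finset.mul_sum, sum_X_mul_esymmAvoid, sum_X_mul_esymmAvoid]
  push_cast
  ring

end Identities

/-! ### Positivity, uniformly in the number of variables -/

/-- A family of polynomials given by one nonnegative combination of products of elementary symmetric
polynomials of total degree `N`. -/
def EPosFamily (N : ℕ) (f : ∀ n, MvPolynomial (Fin n) ℚ) : Prop :=
  ∃ c : Nat.Partition N → ℚ, (∀ p, 0 ≤ c p) ∧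
    ∀ n, f n = ∑ p, c p • (p.parts.map fun r => esymm (Fin n) ℚ r).prod

namespace EPosFamily

variable {N : ℕ} {f g : ∀ n, MvPolynomial (Fin n) ℚ}

lemma one : EPosFamily 0 fun _ => 1 :=
  ⟨fun _ => 1, fun _ => zero_le_one, fun n => by simp [Nat.Partition.partition_zero_parts]⟩

lemma add (hf : EPosFamily N f) (hg : EPosFamily N g) :
    EPosFamily N fun n => f n + g n := by
  obtain ⟨c, hc, hf⟩ := hf
  obtain ⟨d, hd, hg⟩ := hg
  exact ⟨c + d, fun p => add_nonneg (hc p) (hd p), fun n => by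
    simp [hf, hg, add_smul, Finset.sum_add_distrib]⟩

lemma natCast_mul (hf : EPosFamily N f) (a : ℕ) :
    EPosFamily N fun n => (a : MvPolynomial (Fin n) ℚ) * f n := by
  obtain ⟨c, hc, hf⟩ := hf
  refine ⟨fun p => a * c p, fun p => mul_nonneg a.cast_nonneg (hc p), fun n => ?_⟩
  beta_reduce
  rw [hf, ← nsmul_eq_mul, ← Nat.cast_smul_eq_nsmul ℚ, Finset.smul_sum]
  simp only [mul_smul]

lemma esymm_mul (hf : EPosFamily N f) (k : ℕ) :
    EPosFamily (k + 1 + N) fun n => esymm (Fin n) ℚ (k + 1) * f n := by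
  obtain ⟨c, hc, hf⟩ := hf
  let φ : Nat.Partition N → Nat.Partition (k + 1 + N) := fun p =>
    ⟨(k + 1) ::ₘ p.parts, by
      intro i hi
      rcases Multiset.mem_cons.mp hi with rfl | hi
      · omega
      · exact p.parts_pos hi, by rw [Multiset.sum_cons, p.parts_sum]⟩
  refine ⟨fun q => ∑ p, if φ p = q then c p else 0,
    fun q => Finset.sum_nonneg fun p _ => by split_ifs <;> simp [hc], fun n => ?_⟩
  simp only [Finset.sum_smul, ite_smul, zero_smul]
  rw [Finset.sum_comm, hf, Finset.mul_sum]
  refine Finset.sum_congr rfl fun p _ => ?_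
  simp [φ]

lemma esymm_succ (k : ℕ) : EPosFamily (k + 1) fun n => esymm (Fin n) ℚ (k + 1) := by
  simpa using one.esymm_mul k

lemma pairing_of_le {j k : ℕ} (h : j ≤ k) :
    EPosFamily (j + k + 1) fun n => ∑ c : Fin n, X c * esymmAvoid j c * esymmAvoid k c := by
  induction j generalizing k with
  | zero =>
    have := (esymm_succ k).natCast_mul (k + 1)
    simp only [← sum_X_mul_esymmAvoid] at this
    simpa [esymmAvoid] using this
  | succ j ih =>
    have h1 := ih (k := k + 1) (by omega)
    have h2 := ((esymm_succ k).esymm_mul j).natCast_mul (k - j)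
    rw [show j + 1 + (k + 1) = j + (k + 1) + 1 by omega] at h2
    rw [show j + 1 + k + 1 = j + (k + 1) + 1 by omega]
    convert h1.add h2 using 2 with n
    rw [sum_X_mul_esymmAvoid_mul_succ, Nat.cast_sub (by omega)]

lemma pairing (j k : ℕ) :
    EPosFamily (j + k + 1) fun n => ∑ c : Fin n, X c * esymmAvoid j c * esymmAvoid k c := by
  rcases le_total j k with h | h
  · exact pairing_of_le h
  · have := pairing_of_le h
    rw [add_comm k j] at this
    simpa only [mul_right_comm] using this

end EPosFamily

/-- Families of colour-indexed polynomials of degree `N` that are nonnegative combinations of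
products of elementary symmetric polynomials with one factor `esymmAvoid k`. -/
inductive PointedEPos : ℕ → (∀ n, Fin n → MvPolynomial (Fin n) ℚ) → Prop
  | esymmAvoid (k : ℕ) : PointedEPos k fun _ => esymmAvoid k
  | add {N f g} : PointedEPos N f → PointedEPos N g → PointedEPos N fun n c => f n c + g n c
  | natCast_mul {N f} (a : ℕ) : PointedEPos N f →
      PointedEPos N fun n c => (a : MvPolynomial (Fin n) ℚ) * f n c
  | esymm_mul {N f} (k : ℕ) : PointedEPos N f →
      PointedEPos (k + 1 + N) fun n c => esymm (Fin n) ℚ (k + 1) * f n c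

namespace PointedEPos

variable {M N : ℕ} {f g : ∀ n, Fin n → MvPolynomial (Fin n) ℚ}

lemma zero (N : ℕ) : PointedEPos N fun _ _ => 0 := by
  simpa using (PointedEPos.esymmAvoid N).natCast_mul 0

lemma sum {ι : Type*} (s : Finset ι) (F : ι → ∀ n, Fin n → MvPolynomial (Fin n) ℚ)
    (h : ∀ i ∈ s, PointedEPos N (F i)) : PointedEPos N fun n c => ∑ i ∈ s, F i n c := by
  induction s using Finset.induction_on with
  | empty => simpa using zero N
  | insert i s hi ih =>
    simp only [Finset.sum_insert hi]
    exact (h i (by simp)).add (ih fun j hj => h j (by simp [hj]))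

lemma walkStep (hf : PointedEPos N f) : PointedEPos (N + 1) fun n => walkStep (f n) := by
  induction hf with
  | esymmAvoid k =>
    have h := (((PointedEPos.esymmAvoid 0).esymm_mul k).natCast_mul k).add
      (PointedEPos.esymmAvoid (k + 1))
    simp only [walkStep_esymmAvoid]
    simpa [_root_.esymmAvoid] using h
  | add _ _ ihf ihg =>
    convert ihf.add ihg using 2 with n
    exact walkStep_add _ _
  | natCast_mul a _ ih =>
    convert ih.natCast_mul a using 2 with n
    exact walkStep_mul _ _
  | esymm_mul k _ ih =>
    simp only [walkStep_mul]
    exact ih.esymm_mul k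

lemma iterate_walkStep (hf : PointedEPos N f) (l : ℕ) :
    PointedEPos (N + l) fun n => _root_.walkStep^[l] (f n) := by
  induction l with
  | zero => exact hf
  | succ l ih =>
    simp only [Function.iterate_succ_apply']
    exact ih.walkStep

lemma cyclePoly (k : ℕ) : PointedEPos k fun _ => cyclePoly k := by
  induction k using Nat.strong_induction_on with
  | _ k ih =>
    have h : (fun n => _root_.cyclePoly (n := n) k) = fun n c =>
        (k : MvPolynomial (Fin n) ℚ) * _root_.esymmAvoid k c + ∑ i ∈ Finset.range k,
          (i : MvPolynomial (Fin n) ℚ) * (esymm (Fin n) ℚ (i + 1) *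
            _root_.cyclePoly (k - (i + 1)) c) := by
      funext n c
      rw [cyclePoly_eq]
      simp only [mul_assoc]
    rw [h]
    refine ((PointedEPos.esymmAvoid k).natCast_mul k).add
      (sum _ (fun i n c => (i : MvPolynomial (Fin n) ℚ) * (esymm (Fin n) ℚ (i + 1) *
            _root_.cyclePoly (k - (i + 1)) c)) fun i hi => natCast_mul i ?_)
    have hi' := Finset.mem_range.mp hi
    have := (ih (k - (i + 1)) (by omega)).esymm_mul i
    rwa [show i + 1 + (k - (i + 1)) = k by omega] at this

/-- Gluing two pointed families at their points. -/
lemma pairing (hf : PointedEPos M f) (hg : PointedEPos N g) :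
    EPosFamily (M + N + 1) fun n => ∑ c, X c * f n c * g n c := by
  induction hf with
  | esymmAvoid j =>
    induction hg with
    | esymmAvoid k => exact EPosFamily.pairing j k
    | add _ _ ihf ihg =>
      simpa only [mul_add, Finset.sum_add_distrib] using ihf.add ihg
    | natCast_mul a _ ih =>
      simpa only [Finset.mul_sum, mul_left_comm, mul_assoc] using ih.natCast_mul a
    | @esymm_mul N' _ k _ ih =>
      have := ih.esymm_mul k
      rw [show k + 1 + (j + N' + 1) = j + (k + 1 + N') + 1 by omega] at this
      simpa only [Finset.mul_sum, mul_left_comm, mul_assoc] using this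
  | add _ _ ihf ihg =>
    simpa only [mul_add, add_mul, Finset.sum_add_distrib] using ihf.add ihg
  | natCast_mul a _ ih =>
    simpa only [Finset.mul_sum, mul_left_comm, mul_assoc] using ih.natCast_mul a
  | @esymm_mul M' _ k _ ih =>
    have := ih.esymm_mul k
    rw [show k + 1 + (M' + N + 1) = k + 1 + M' + N + 1 by omega] at this
    simpa only [Finset.mul_sum, mul_left_comm, mul_assoc] using this

end PointedEPos

/-! ### Sums over proper colourings -/

/-- `κ` is a proper colouring of `G`. -/
def IsProperCol {V K : Type*} (G : SimpleGraph V) (κ : V → K) : Prop :=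
  ∀ u v, G.Adj u v → κ u ≠ κ v

/-- The sum over the proper colourings of `G`, with an extra weight `f` at the last vertex. -/
def colSum {p n : ℕ} (hp : 0 < p) (G : SimpleGraph (Fin p))
    (f : Fin n → MvPolynomial (Fin n) ℚ) : MvPolynomial (Fin n) ℚ :=
  ∑ κ : Fin p → Fin n,
    if IsProperCol G κ then (∏ v, X (κ v)) * f (κ ⟨p - 1, by omega⟩) else 0

/-- The sum over the proper colourings of `H` whose first vertex has colour `c`, omitting the
variable of the first vertex, with an extra weight `f` at the last vertex. -/
def rootedColSum {b n : ℕ} (H : SimpleGraph (Fin (b + 1)))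
    (f : Fin n → MvPolynomial (Fin n) ℚ) (c : Fin n) : MvPolynomial (Fin n) ℚ :=
  ∑ β : Fin b → Fin n,
    if IsProperCol H (Fin.cons c β : Fin (b + 1) → Fin n) then
      (∏ v, X (β v)) * f ((Fin.cons c β : Fin (b + 1) → Fin n) (Fin.last b)) else 0

lemma cspoly_eq_colSum {p n : ℕ} (hp : 0 < p) (G : SimpleGraph (Fin p)) :
    cspoly G n = colSum hp G 1 := by
  rw [cspoly, colSum, Finset.sum_filter]
  simp only [IsProperCol, Pi.one_apply, mul_one]
  congr!

/-- The right half of an appended colouring, starting at the shared vertex. -/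
lemma append_shift {K : Type*} {p b : ℕ} (hp : 0 < p) (α : Fin p → K) (β : Fin b → K)
    (j : Fin (b + 1)) (h : (j : ℕ) + (p - 1) < p + b) :
    Fin.append α β ⟨j + (p - 1), h⟩ =
      (Fin.cons (α ⟨p - 1, by omega⟩) β : Fin (b + 1) → K) j := by
  cases j using Fin.cases with
  | zero =>
    have : (⟨((0 : Fin (b + 1)) : ℕ) + (p - 1), h⟩ : Fin (p + b)) =
        Fin.castAdd b ⟨p - 1, by omega⟩ := by ext; simp
    rw [this, Fin.append_left, Fin.cons_zero]
  | succ j =>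
    have : (⟨(j.succ : ℕ) + (p - 1), h⟩ : Fin (p + b)) = Fin.natAdd p j := by
      ext; simp; omega
    rw [this, Fin.append_right, Fin.cons_succ]

lemma isProperCol_fromRel {V K : Type*} (r : V → V → Prop) (κ : V → K) :
    IsProperCol (SimpleGraph.fromRel r) κ ↔ ∀ u v, u ≠ v → r u v → κ u ≠ κ v := by
  simp only [IsProperCol, SimpleGraph.fromRel_adj]
  exact ⟨fun h u v huv hr => h u v ⟨huv, Or.inl hr⟩,
    fun h u v ⟨huv, hr⟩ => hr.elim (h u v huv) fun hr => (h v u huv.symm hr).symm⟩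

lemma isProperCol_concatG {K : Type*} {p b : ℕ} (hp : 0 < p) (G : SimpleGraph (Fin p))
    (H : SimpleGraph (Fin (b + 1))) (α : Fin p → K) (β : Fin b → K) :
    IsProperCol (concatG G H) (Fin.append α β : Fin (p + b) → K) ↔
      IsProperCol G α ∧
        IsProperCol H (Fin.cons (α ⟨p - 1, by omega⟩) β : Fin (b + 1) → K) := by
  rw [concatG, isProperCol_fromRel]
  constructor
  · refine fun h => ⟨fun i j hij => ?_, fun i j hij => ?_⟩
    · have := h (Fin.castAdd b i) (Fin.castAdd b j)
        (by simpa using hij.ne) (Or.inl ⟨i, j, hij, rfl, rfl⟩)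
      simpa only [Fin.append_left] using this
    · have hi := i.isLt
      have hj := j.isLt
      have := h ⟨i + (p - 1), by omega⟩ ⟨j + (p - 1), by omega⟩
        (by simpa [Fin.ext_iff] using hij.ne) (Or.inr ⟨i, j, hij, rfl, rfl⟩)
      rw [← append_shift hp α β i (by omega), ← append_shift hp α β j (by omega)]
      exact this
  · rintro ⟨hG, hH⟩ ⟨u, hu⟩ ⟨v, hv⟩ - (⟨i, j, hij, h1, h2⟩ | ⟨i, j, hij, h1, h2⟩)
    · have := hG i j hij
      rw [← Fin.append_left α β i, ← Fin.append_left α β j] at this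
      simp only at h1 h2
      subst h1 h2
      exact this
    · have := hH i j hij
      simp only at h1 h2
      subst h1 h2
      rw [← append_shift hp α β i (by omega), ← append_shift hp α β j (by omega)] at this
      exact this

lemma colSum_concatG {p b n : ℕ} (hp : 0 < p) (G : SimpleGraph (Fin p))
    (H : SimpleGraph (Fin (b + 1))) (hpb : 0 < p + (b + 1) - 1)
    (f : Fin n → MvPolynomial (Fin n) ℚ) :
    colSum hpb (concatG G H) f = colSum hp G (rootedColSum H f) := by
  have key : ∀ (α : Fin p → Fin n) (β : Fin b → Fin n), Fin.append α β ⟨p + b - 1, by omega⟩ =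
      (Fin.cons (α ⟨p - 1, by omega⟩) β : Fin (b + 1) → Fin n) (Fin.last b) := by
    intro α β
    rw [← append_shift hp α β _ (by simp; omega)]
    congr 2
    simp; omega
  unfold colSum
  refine (Equiv.sum_comp (Fin.appendEquiv p b (α := Fin n)) (fun κ : Fin (p + b) → Fin n =>
    if IsProperCol (concatG G H) κ then (∏ v : Fin (p + b), (X (κ v) : MvPolynomial (Fin n) ℚ)) *
      f (κ ⟨p + b - 1, by omega⟩) else 0)).symm.trans ?_
  rw [Fintype.sum_prod_type]
  refine Finset.sum_congr rfl fun α _ => ?_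
  simp only [Fin.appendEquiv, Equiv.coe_fn_mk, isProperCol_concatG hp, rootedColSum,
    Fin.prod_univ_add, Fin.append_left, Fin.append_right, key]
  split_ifs with h
  · simp only [h, true_and, Finset.mul_sum, mul_ite, mul_zero, mul_assoc]
  · simp [h]

lemma isProperCol_pathG_cons {K : Type*} {l : ℕ} (c d : K) (β : Fin l → K) :
    IsProperCol (PathG (l + 2)) (Fin.cons c (Fin.cons d β : Fin (l + 1) → K) : Fin (l + 2) → K) ↔
      d ≠ c ∧ IsProperCol (PathG (l + 1)) (Fin.cons d β : Fin (l + 1) → K) := by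
  simp only [PathG, isProperCol_fromRel]
  constructor
  · refine fun h => ⟨?_, fun u v huv hr => ?_⟩
    · simpa using (h 0 1 (by simp) (by simp)).symm
    · simpa using h u.succ v.succ (by simpa using huv) (by simpa using hr)
  · rintro ⟨h0, h⟩ u v huv hr
    cases v using Fin.cases with
    | zero => simp at hr
    | succ v =>
      cases u using Fin.cases with
      | zero =>
        have : v = 0 := by ext; simpa using hr
        subst this
        simpa using h0.symm
      | succ u => simpa using h u v (by simpa using huv) (by simpa using hr)

lemma rootedColSum_pathG {n : ℕ} (l : ℕ) (f : Fin n → MvPolynomial (Fin n) ℚ) :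
    rootedColSum (PathG (l + 1)) f = walkStep^[l] f := by
  induction l with
  | zero =>
    ext1 c
    have : ∀ β : Fin 0 → Fin n, IsProperCol (PathG 1) (Fin.cons c β : Fin 1 → Fin n) :=
      fun β u v h => absurd (Subsingleton.elim u v) h.ne
    simp [rootedColSum, this]
  | succ l ih =>
    rw [Function.iterate_succ_apply', ← ih]
    ext1 c
    rw [rootedColSum, ← Equiv.sum_comp (Fin.consEquiv fun _ : Fin (l + 1) => Fin n),
      Fintype.sum_prod_type, walkStep, ← Finset.sum_erase_eq_sub (Finset.mem_univ c),
      ← Finset.sum_erase _ (a := c)]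
    · refine Finset.sum_congr rfl fun d hd => ?_
      have hd' := Finset.ne_of_mem_erase hd
      rw [rootedColSum, Finset.mul_sum]
      refine Finset.sum_congr rfl fun β _ => ?_
      simp only [Fin.consEquiv, Equiv.coe_fn_mk, isProperCol_pathG_cons, hd', ne_eq,
        not_false_eq_true, true_and, Fin.prod_univ_succ, Fin.cons_zero, Fin.cons_succ, mul_ite,
        mul_zero, mul_assoc, ← Fin.succ_last]
    · simp [Fin.consEquiv, isProperCol_pathG_cons]

lemma isProperCol_cycleG {K : Type*} {k : ℕ} (hk : 0 < k) (κ : Fin (k + 1) → K) :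
    IsProperCol (CycleG (k + 1)) κ ↔
      IsProperCol (PathG (k + 1)) κ ∧ κ (Fin.last k) ≠ κ 0 := by
  simp only [CycleG, PathG, isProperCol_fromRel]
  constructor
  · refine fun h => ⟨fun u v huv hr => h u v huv (Or.inl hr), ?_⟩
    exact (h 0 (Fin.last k) (by simp [Fin.ext_iff]; omega) (Or.inr (by simp))).symm
  · rintro ⟨h, h0⟩ u v huv (hr | ⟨hu, hv⟩)
    · exact h u v huv hr
    · have hu' : u = 0 := by ext; simpa using hu
      have hv' : v = Fin.last k := by ext; simpa using hv
      rw [hu', hv']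
      exact h0.symm

lemma rootedColSum_cycleG {n k : ℕ} (hk : 0 < k) (c : Fin n) :
    rootedColSum (CycleG (k + 1)) 1 c = cyclePoly k c := by
  rw [cyclePoly, ← rootedColSum_pathG, rootedColSum, rootedColSum]
  refine Finset.sum_congr rfl fun β _ => ?_
  simp only [isProperCol_cycleG hk, Fin.cons_zero, Pi.one_apply, mul_one, mul_ite, mul_zero]
  split_ifs <;> simp_all

lemma isProperCol_cycleG_rev {K : Type*} {k : ℕ} (κ : Fin (k + 1) → K) :
    IsProperCol (CycleG (k + 1)) (κ ∘ Fin.rev) ↔ IsProperCol (CycleG (k + 1)) κ := by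
  have h : ∀ κ : Fin (k + 1) → K, IsProperCol (CycleG (k + 1)) κ →
      IsProperCol (CycleG (k + 1)) (κ ∘ Fin.rev) := by
    intro κ h
    simp only [CycleG, isProperCol_fromRel] at h ⊢
    intro u v huv hr
    refine (h v.rev u.rev (by simpa using huv.symm) ?_).symm
    simp only [Fin.val_rev]
    omega
  refine ⟨fun hκ => ?_, h κ⟩
  have := h _ hκ
  rwa [Function.comp_assoc, Fin.rev_involutive.comp_self, Function.comp_id] at this

lemma colSum_cycleG {n k : ℕ} (hk : 0 < k) (f : Fin n → MvPolynomial (Fin n) ℚ) :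
    colSum k.succ_pos (CycleG (k + 1)) f = ∑ c, X c * cyclePoly k c * f c := by
  rw [colSum, ← Equiv.sum_comp (Equiv.arrowCongr Fin.revPerm (Equiv.refl (Fin n))),
    ← Equiv.sum_comp (Fin.consEquiv fun _ : Fin (k + 1) => Fin n), Fintype.sum_prod_type]
  refine Finset.sum_congr rfl fun c _ => ?_
  rw [← rootedColSum_cycleG hk, rootedColSum, Finset.mul_sum, Finset.sum_mul]
  refine Finset.sum_congr rfl fun β _ => ?_
  set κ : Fin (k + 1) → Fin n := Fin.cons c β with hκ
  have h1 : Equiv.arrowCongr Fin.revPerm (Equiv.refl (Fin n))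
      (Fin.consEquiv (fun _ : Fin (k + 1) => Fin n) (c, β)) = κ ∘ Fin.rev := rfl
  have h2 : (∏ v, X ((κ ∘ Fin.rev) v) : MvPolynomial (Fin n) ℚ) = X c * ∏ v, X (β v) := by
    rw [← Equiv.prod_comp Fin.revPerm, Fin.prod_univ_succ]
    simp [hκ]
  have h3 : (κ ∘ Fin.rev) ⟨k + 1 - 1, by omega⟩ = c := by
    have : Fin.rev (⟨k + 1 - 1, by omega⟩ : Fin (k + 1)) = 0 := by ext; simp
    rw [Function.comp_apply, this, hκ, Fin.cons_zero]
  rw [h1, isProperCol_cycleG_rev, h2, h3]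
  simp

theorem stmt14 (m n l : ℕ) (hm : 3 ≤ m) (hn : 3 ≤ n) :
    EPos (concatG (concatG (CycleG m) (PathG (l + 1))) (CycleG n)) := by
  obtain ⟨j, rfl⟩ : ∃ j, m = j + 1 := ⟨m - 1, by omega⟩
  obtain ⟨k, rfl⟩ : ∃ k, n = k + 1 := ⟨n - 1, by omega⟩
  have key : ∀ N, cspoly (concatG (concatG (CycleG (j + 1)) (PathG (l + 1))) (CycleG (k + 1))) N =
      ∑ c : Fin N, X c * cyclePoly j c * walkStep^[l] (cyclePoly k) c := by
    intro N
    rw [cspoly_eq_colSum (by omega), colSum_concatG (by omega), colSum_concatG (by omega),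
      colSum_cycleG (by omega), rootedColSum_pathG]
    simp only [funext fun c : Fin N => rootedColSum_cycleG (n := N) (k := k) (by omega) c]
  have h := (PointedEPos.cyclePoly j).pairing ((PointedEPos.cyclePoly k).iterate_walkStep l)
  simp only [← key] at h
  have hcard : j + (k + l) + 1 =
      Fintype.card (Fin (j + 1 + (l + 1) - 1 + (k + 1) - 1)) := by
    rw [Fintype.card_fin]
    omega
  rw [hcard] at h
  exact h
end
end

section
/- Let G be a finite simple graph on d vertices and let v be a cut vertex of G, i.e., there exist vertices a, b of G, both distinct from v, that are joined by a walk in G but by no walk in the vertex-deleted graph G − v. Then for every bijective labelling of the vertices of G by {1,…,d} in which v is labelled d, the resulting labelled graph is not (e)-positive. -/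
open scoped Classical
noncomputable section

/-- Removing the edges at `v`. -/
def isolateVertex {V : Type} (G : SimpleGraph V) (v : V) : SimpleGraph V where
  Adj x y := G.Adj x y ∧ x ≠ v ∧ y ≠ v
  symm := ⟨fun _ _ h => ⟨h.1.symm, h.2.2, h.2.1⟩⟩
  loopless := ⟨fun x h => G.loopless.irrefl x h.1⟩

/-- The number of proper colourings of `G` with `N` colours. -/
def colouringCount {V : Type} (G : SimpleGraph V) (N : ℕ) : ℕ :=
  Nat.card {κ : V → Fin N // ∀ j k, G.Adj j k → κ j ≠ κ k}

/-- The retraction of `V` onto the complement of `u` which sends `u` to `v`. -/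
def mergeInto {V : Type} (u v : V) (huv : v ≠ u) (x : V) : {x : V // x ≠ u} :=
  if h : x = u then ⟨v, huv⟩ else ⟨x, h⟩

/-- The contraction of `G` which identifies `u` with `v`. -/
def contraction {V : Type} (G : SimpleGraph V) (u v : V) (huv : v ≠ u) :
    SimpleGraph {x : V // x ≠ u} where
  Adj x y := x ≠ y ∧ ∃ a b, mergeInto u v huv a = x ∧ mergeInto u v huv b = y ∧ G.Adj a b
  symm := ⟨fun _ _ ⟨hne, a, b, ha, hb, hab⟩ => ⟨hne.symm, b, a, hb, ha, hab.symm⟩⟩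
  loopless := ⟨fun _ h => h.1 rfl⟩

section Contraction

variable {V : Type} (G : SimpleGraph V) {u v : V}

theorem mergeInto_val (huv : v ≠ u) (x : {x : V // x ≠ u}) : mergeInto u v huv x.1 = x := by
  simp [mergeInto, x.2]

theorem mergeInto_self (huv : v ≠ u) : (mergeInto u v huv u).1 = v := by
  simp [mergeInto]

theorem mergeInto_of_ne (huv : v ≠ u) {x : V} (h : x ≠ u) : (mergeInto u v huv x).1 = x := by
  simp [mergeInto, h]

theorem mergeInto_eq_iff_of_adj (huv : v ≠ u) {a b : V} (hab : G.Adj a b) :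
    mergeInto u v huv a = mergeInto u v huv b ↔ s(a, b) = s(u, v) := by
  have hne := hab.ne
  rw [Subtype.ext_iff, Sym2.eq_iff]
  by_cases ha : a = u <;> by_cases hb : b = u
  · exact absurd (ha.trans hb.symm) hne
  · subst ha; rw [mergeInto_self, mergeInto_of_ne huv hb]; simp [eq_comm, huv]
  · subst hb; rw [mergeInto_self, mergeInto_of_ne huv ha]; simp [huv.symm]
  · rw [mergeInto_of_ne huv ha, mergeInto_of_ne huv hb]; simp [ha, hb, hne]

theorem reachable_mergeInto (h : G.Adj u v) (huv : v ≠ u) (x : V) :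
    G.Reachable x (mergeInto u v huv x).1 := by
  by_cases hx : x = u
  · subst hx; rw [mergeInto_self]; exact h.reachable
  · rw [mergeInto_of_ne huv hx]

theorem contraction_reachable (huv : v ≠ u) {a b : V} (hab : G.Reachable a b) :
    (contraction G u v huv).Reachable (mergeInto u v huv a) (mergeInto u v huv b) := by
  obtain ⟨w⟩ := hab
  induction w with
  | nil => rfl
  | @cons x y _ hadj _ ih =>
    refine SimpleGraph.Reachable.trans ?_ ih
    by_cases he : mergeInto u v huv x = mergeInto u v huv y
    · rw [he]
    · exact SimpleGraph.Adj.reachable ⟨he, _, _, rfl, rfl, hadj⟩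

theorem reachable_of_contraction (h : G.Adj u v) (huv : v ≠ u) {x y : {x : V // x ≠ u}}
    (hxy : (contraction G u v huv).Reachable x y) : G.Reachable x.1 y.1 := by
  obtain ⟨w⟩ := hxy
  induction w with
  | nil => rfl
  | cons hadj _ ih =>
    obtain ⟨_, a, b, rfl, rfl, hab⟩ := hadj
    exact ((reachable_mergeInto G h huv a).symm.trans
      (hab.reachable.trans (reachable_mergeInto G h huv b))).trans ih

theorem card_connectedComponent_contraction (h : G.Adj u v) (huv : v ≠ u) :
    Nat.card (contraction G u v huv).ConnectedComponent = Nat.card G.ConnectedComponent := by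
  refine Nat.card_congr (Equiv.ofBijective
    (SimpleGraph.ConnectedComponent.lift (fun x => G.connectedComponentMk x.1) ?_) ⟨?_, ?_⟩)
  · intro x y p _
    exact SimpleGraph.ConnectedComponent.sound (reachable_of_contraction G h huv p.reachable)
  · intro C D
    induction C using SimpleGraph.ConnectedComponent.ind with | _ x
    induction D using SimpleGraph.ConnectedComponent.ind with | _ y
    intro hxy
    have := contraction_reachable G huv (SimpleGraph.ConnectedComponent.exact hxy)
    rw [mergeInto_val, mergeInto_val] at this
    exact SimpleGraph.ConnectedComponent.sound this
  · intro C
    induction C using SimpleGraph.ConnectedComponent.ind with | _ x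
    exact ⟨(contraction G u v huv).connectedComponentMk (mergeInto u v huv x),
      SimpleGraph.ConnectedComponent.sound (reachable_mergeInto G h huv x).symm⟩

theorem colouringCount_deleteEdges [Finite V] (h : G.Adj u v) (huv : v ≠ u) (N : ℕ) :
    colouringCount (G.deleteEdges {s(u, v)}) N =
      colouringCount G N + colouringCount (contraction G u v huv) N := by
  have e₁ : {κ : V → Fin N // ∀ j k, G.Adj j k → κ j ≠ κ k} ≃
      {κ : {κ : V → Fin N // ∀ j k, (G.deleteEdges {s(u, v)}).Adj j k → κ j ≠ κ k} //
        κ.1 u ≠ κ.1 v} :=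
    { toFun := fun κ => ⟨⟨κ.1, fun j k hjk =>
        κ.2 j k (SimpleGraph.deleteEdges_adj.1 hjk).1⟩, κ.2 u v h⟩
      invFun := fun κ => ⟨κ.1.1, fun j k hjk => by
        by_cases he : s(j, k) = s(u, v)
        · rcases Sym2.eq_iff.1 he with ⟨rfl, rfl⟩ | ⟨rfl, rfl⟩
          · exact κ.2
          · exact κ.2.symm
        · exact κ.1.2 j k (SimpleGraph.deleteEdges_adj.2 ⟨hjk, he⟩)⟩
      left_inv := fun _ => rfl
      right_inv := fun _ => rfl }
  have e₂ : {κ : {x : V // x ≠ u} → Fin N //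
        ∀ j k, (contraction G u v huv).Adj j k → κ j ≠ κ k} ≃
      {κ : {κ : V → Fin N // ∀ j k, (G.deleteEdges {s(u, v)}).Adj j k → κ j ≠ κ k} //
        ¬ κ.1 u ≠ κ.1 v} :=
    { toFun := fun κ => ⟨⟨fun x => κ.1 (mergeInto u v huv x), fun j k hjk => by
          obtain ⟨hadj, hne⟩ := SimpleGraph.deleteEdges_adj.1 hjk
          exact κ.2 _ _ ⟨fun he => hne ((mergeInto_eq_iff_of_adj G huv hadj).1 he),
            j, k, rfl, rfl, hadj⟩⟩, by
        have : mergeInto u v huv u = mergeInto u v huv v :=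
          (mergeInto_eq_iff_of_adj G huv h).2 rfl
        simp [this]⟩
      invFun := fun κ => ⟨fun x => κ.1.1 x.1, by
        have hκ : ∀ x, κ.1.1 (mergeInto u v huv x).1 = κ.1.1 x := fun x => by
          by_cases hx : x = u
          · rw [hx, mergeInto_self]; exact (not_not.1 κ.2).symm
          · rw [mergeInto_of_ne huv hx]
        rintro _ _ ⟨hne, a, b, rfl, rfl, hab⟩
        simp only [hκ]
        exact κ.1.2 a b (SimpleGraph.deleteEdges_adj.2
          ⟨hab, fun he => hne ((mergeInto_eq_iff_of_adj G huv hab).2 he)⟩)⟩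
      left_inv := fun κ => by
        ext x
        simp [mergeInto_val]
      right_inv := fun κ => by
        ext x
        by_cases hx : x = u
        · subst hx; simp [mergeInto_self, not_not.1 κ.2]
        · simp [mergeInto_of_ne huv hx] }
  rw [colouringCount, colouringCount, colouringCount, Nat.card_congr e₁, Nat.card_congr e₂,
    ← Nat.card_sum]
  exact Nat.card_congr (Equiv.sumCompl _).symm

end Contraction

theorem card_connectedComponent_le_of_le {V : Type} [Finite V] {G H : SimpleGraph V}
    (h : H ≤ G) : Nat.card G.ConnectedComponent ≤ Nat.card H.ConnectedComponent := by
  refine Nat.card_le_card_of_surjective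
    (SimpleGraph.ConnectedComponent.map (SimpleGraph.Hom.ofLE h)) fun C => ?_
  induction C using SimpleGraph.ConnectedComponent.ind with | _ x
  exact ⟨H.connectedComponentMk x, rfl⟩

theorem card_connectedComponent_bot (V : Type) :
    Nat.card (⊥ : SimpleGraph V).ConnectedComponent = Nat.card V := by
  refine (Nat.card_congr (Equiv.ofBijective (⊥ : SimpleGraph V).connectedComponentMk
    ⟨fun x y hxy => ?_, fun C => ?_⟩)).symm
  · exact SimpleGraph.reachable_bot.1 (SimpleGraph.ConnectedComponent.exact hxy)
  · induction C using SimpleGraph.ConnectedComponent.ind with | _ x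
    exact ⟨x, rfl⟩

/-- The chromatic polynomial exists, and its absolute value at `-t` is of the exact order
`t ^ c` as `t → 0⁺`, where `c` is the number of connected components. -/
theorem exists_chromaticPolynomial (n : ℕ) : ∀ (V : Type) [Finite V], Nat.card V = n →
    ∀ G : SimpleGraph V, ∃ p : Polynomial ℚ,
      (∀ N : ℕ, p.eval (N : ℚ) = colouringCount G N) ∧
      ∃ C : ℚ, ∀ t : ℚ, 0 < t → t ≤ 1 →
        t ^ Nat.card G.ConnectedComponent ≤ (-1) ^ n * p.eval (-t) ∧
        (-1) ^ n * p.eval (-t) ≤ C * t ^ Nat.card G.ConnectedComponent := by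
  induction n with
  | zero =>
    intro V _ hV G
    have : IsEmpty V := (Finite.card_eq_zero_iff).1 hV
    exact ⟨1, fun N => by simp [colouringCount], 1, fun t _ _ => by simp⟩
  | succ n ihn =>
    intro V _ hV G
    induction G using WellFoundedLT.induction with
    | ind G ih =>
    by_cases hG : G = ⊥
    · subst hG
      refine ⟨Polynomial.X ^ (n + 1), fun N => ?_, 1, fun t _ _ => ?_⟩
      · have : Fintype V := Fintype.ofFinite V
        rw [Nat.card_eq_fintype_card] at hV
        simp [colouringCount, hV, Nat.card_eq_fintype_card, Fintype.card_subtype_true]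
      · rw [card_connectedComponent_bot, hV, Polynomial.eval_pow, Polynomial.eval_X, ← mul_pow]
        simp
    · obtain ⟨u, v, huv⟩ := SimpleGraph.ne_bot_iff_exists_adj.1 hG
      have hlt : G.deleteEdges {s(u, v)} < G := by
        refine lt_of_le_of_ne (SimpleGraph.deleteEdges_le _) fun he => ?_
        rw [← he, SimpleGraph.deleteEdges_adj] at huv
        exact huv.2 rfl
      obtain ⟨p, hp, C, hC⟩ := ih _ hlt
      have hcard : Nat.card {x : V // x ≠ u} = n := by
        have : Fintype V := Fintype.ofFinite V
        rw [Nat.card_eq_fintype_card] at hV ⊢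
        rw [Fintype.card_subtype_compl, hV]
        simp
      obtain ⟨q, hq, D, hD⟩ := ihn {x : V // x ≠ u} hcard (contraction G u v huv.ne')
      rw [card_connectedComponent_contraction G huv huv.ne'] at hD
      refine ⟨p - q, fun N => ?_, C + D, fun t ht ht1 => ?_⟩
      · rw [Polynomial.eval_sub, hp, hq, colouringCount_deleteEdges G huv huv.ne']
        push_cast
        ring
      · have hle := pow_le_pow_of_le_one ht.le ht1 (card_connectedComponent_le_of_le hlt.le)
        have hC1 := hC 1 one_pos le_rfl
        have hC0 : 0 ≤ C := by
          have := hC1.1.trans hC1.2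
          simp only [one_pow, mul_one] at this
          linarith
        have hpos := pow_pos ht (Nat.card (G.deleteEdges {s(u, v)}).ConnectedComponent)
        obtain ⟨h₁, h₂⟩ := hC t ht ht1
        obtain ⟨h₃, h₄⟩ := hD t ht ht1
        have h₅ := mul_le_mul_of_nonneg_left hle hC0
        rw [Polynomial.eval_sub, pow_succ] at *
        constructor <;> linarith

theorem reachable_isolateVertex_or {V : Type} (G : SimpleGraph V) (v : V) {a b : V}
    (hab : G.Reachable a b) : (isolateVertex G v).Reachable a b ∨ G.Reachable a v := by
  obtain ⟨w⟩ := hab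
  induction w with
  | nil => exact Or.inl (SimpleGraph.Reachable.refl _)
  | @cons x y z hadj _ ih =>
    by_cases hx : x = v
    · exact Or.inr (hx ▸ SimpleGraph.Reachable.refl _)
    by_cases hy : y = v
    · exact Or.inr (hy ▸ hadj.reachable)
    have hxy : (isolateVertex G v).Adj x y := ⟨hadj, hx, hy⟩
    exact ih.imp hxy.reachable.trans hadj.reachable.trans

theorem not_reachable_isolateVertex {V : Type} (G : SimpleGraph V) {v a : V} (ha : a ≠ v) :
    ¬ (isolateVertex G v).Reachable v a := by
  rintro ⟨w⟩
  cases w with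
  | nil => exact ha rfl
  | cons h _ => exact h.2.1 rfl

theorem card_connectedComponent_isolateVertex {V : Type} [Finite V] (G : SimpleGraph V)
    {v a b : V} (ha : a ≠ v) (hb : b ≠ v) (hab : G.Reachable a b)
    (hcut : ¬ (isolateVertex G v).Reachable a b) :
    Nat.card G.ConnectedComponent + 2 ≤ Nat.card (isolateVertex G v).ConnectedComponent := by
  set H := isolateVertex G v
  have hav : G.Reachable a v := (reachable_isolateVertex_or G v hab).resolve_left hcut
  have : Fintype G.ConnectedComponent := Fintype.ofFinite _
  have : Fintype H.ConnectedComponent := Fintype.ofFinite _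
  have hle : H ≤ G := fun _ _ h => h.1
  let f : H.ConnectedComponent → G.ConnectedComponent :=
    SimpleGraph.ConnectedComponent.map (SimpleGraph.Hom.ofLE hle)
  have hf : ∀ x, f (H.connectedComponentMk x) = G.connectedComponentMk x := fun _ => rfl
  have hva : H.connectedComponentMk v ≠ H.connectedComponentMk a := fun h =>
    not_reachable_isolateVertex G ha (SimpleGraph.ConnectedComponent.exact h)
  have hvb : H.connectedComponentMk v ≠ H.connectedComponentMk b := fun h =>
    not_reachable_isolateVertex G hb (SimpleGraph.ConnectedComponent.exact h)
  have hba : H.connectedComponentMk a ≠ H.connectedComponentMk b := fun h =>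
    hcut (SimpleGraph.ConnectedComponent.exact h)
  let S : Finset H.ConnectedComponent := {H.connectedComponentMk v, H.connectedComponentMk a}
  have himage : (Sᶜ).image f = Finset.univ := by
    rw [Finset.eq_univ_iff_forall]
    intro C
    rw [Finset.mem_image]
    induction C using SimpleGraph.ConnectedComponent.ind with | _ x
    by_cases hx : H.connectedComponentMk x ∈ S
    · refine ⟨H.connectedComponentMk b, by simp [S, hvb.symm, hba.symm], ?_⟩
      rw [hf]
      apply SimpleGraph.ConnectedComponent.sound
      rcases Finset.mem_insert.1 hx with h | h
      · exact hab.symm.trans (hav.trans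
          ((SimpleGraph.ConnectedComponent.exact h).mono hle).symm)
      · exact hab.symm.trans
          ((SimpleGraph.ConnectedComponent.exact (Finset.mem_singleton.1 h)).mono hle).symm
    · exact ⟨_, Finset.mem_compl.2 hx, hf x⟩
  have h₁ : S.card = 2 := Finset.card_pair hva
  have h₂ := Finset.card_image_le (s := Sᶜ) (f := f)
  have h₃ := Finset.card_add_card_compl S
  rw [himage, Finset.card_univ] at h₂
  rw [Nat.card_eq_fintype_card, Nat.card_eq_fintype_card]
  omega

/-- The polynomial counting the words which are injective on every fibre of `f`. -/
def fibrePoly {α β : Type} [Fintype α] [Fintype β] (f : α → β) : Polynomial ℚ :=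
  ∏ x, descPochhammer ℚ (Nat.card {a // f a = x})

theorem fibrePoly_eval_natCast {α β : Type} [Fintype α] [Fintype β] (f : α → β) (N : ℕ) :
    (fibrePoly f).eval (N : ℚ) =
      Nat.card {κ : α → Fin N // ∀ j k, j ≠ k → f j = f k → κ j ≠ κ k} := by
  have e : {κ : α → Fin N // ∀ j k, j ≠ k → f j = f k → κ j ≠ κ k} ≃
      (∀ x, {a // f a = x} ↪ Fin N) :=
    { toFun := fun κ x => ⟨fun a => κ.1 a.1, fun a b hab => by
        by_contra hne
        exact κ.2 a.1 b.1 (fun h => hne (Subtype.ext h)) (a.2.trans b.2.symm) hab⟩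
      invFun := fun g => ⟨fun a => g (f a) ⟨a, rfl⟩, fun j k hjk hf he => by
        have : ∀ x (h : f k = x), g (f k) ⟨k, rfl⟩ = g x ⟨k, h⟩ := by rintro _ rfl; rfl
        replace he := he.trans (this _ hf.symm)
        exact hjk (congrArg Subtype.val ((g (f j)).injective he))⟩
      left_inv := fun _ => rfl
      right_inv := fun g => by
        funext x
        ext ⟨a, rfl⟩
        rfl }
  rw [Nat.card_congr e, Nat.card_eq_fintype_card, Fintype.card_pi, fibrePoly,
    Polynomial.eval_prod]
  push_cast
  refine Finset.prod_congr rfl fun x _ => ?_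
  rw [descPochhammer_eval_eq_descFactorial, Fintype.card_embedding_eq, Fintype.card_fin,
    Nat.card_eq_fintype_card]

theorem fibrePoly_eval_neg_nonneg {α β : Type} [Fintype α] [Fintype β] (f : α → β) {t : ℚ}
    (ht : 0 < t) : 0 ≤ (-1) ^ Fintype.card α * (fibrePoly f).eval (-t) := by
  rw [← Fintype.card_congr (Equiv.sigmaFiberEquiv f), Fintype.card_sigma,
    ← Finset.prod_pow_eq_pow_sum, fibrePoly, Polynomial.eval_prod, ← Finset.prod_mul_distrib]
  refine Finset.prod_nonneg fun x _ => ?_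
  rw [← Nat.card_eq_fintype_card, ← ascPochhammer_eval_neg_eq_descPochhammer, neg_neg]
  exact (ascPochhammer_pos _ _ ht).le

/-- The labelling obtained from `f` by giving `a` a label of its own. -/
def isolateLabel {α β : Type} (f : α → β) (a : α) (x : α) : Option β :=
  if x = a then none else some (f x)

theorem fibrePoly_isolateLabel {α β : Type} [Fintype α] [Fintype β] (f : α → β) (a : α) :
    fibrePoly (isolateLabel f a) *
        (Polynomial.X - Polynomial.C ((Nat.card {x // f x = f a} : ℚ) - 1)) =
      Polynomial.X * fibrePoly f := by
  have hnone : Nat.card {x // isolateLabel f a x = none} = 1 := by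
    rw [Nat.card_eq_fintype_card, Fintype.card_eq_one_iff]
    refine ⟨⟨a, by simp [isolateLabel]⟩, fun ⟨x, hx⟩ => Subtype.ext ?_⟩
    by_contra h
    simp [isolateLabel, h] at hx
  have hself : Nat.card {x // f x = f a} =
      Nat.card {x // isolateLabel f a x = some (f a)} + 1 := by
    simp only [Nat.card_eq_fintype_card, Fintype.card_subtype]
    rw [← Finset.card_erase_add_one (a := a) (by simp)]
    congr 2
    ext x
    by_cases h : x = a <;> simp [isolateLabel, h]
  have hother : ∀ y ≠ f a, Nat.card {x // isolateLabel f a x = some y} =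
      Nat.card {x // f x = y} := fun y hy => by
    simp only [Nat.card_eq_fintype_card, Fintype.card_subtype]
    congr 1
    ext x
    by_cases h : x = a
    · simp [isolateLabel, h, hy.symm]
    · simp [isolateLabel, h]
  rw [fibrePoly, fibrePoly, Fintype.prod_option, hnone, descPochhammer_one,
    Fintype.prod_eq_mul_prod_compl (f a), Fintype.prod_eq_mul_prod_compl (f a), hself,
    descPochhammer_succ_right, Finset.prod_congr rfl fun y hy => by
      rw [hother y (by simpa using hy)]]
  simp only [Nat.cast_add, Nat.cast_one, add_sub_cancel_right, map_natCast]
  ring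

theorem sameBlock_iff_part_eq {d : ℕ} (π : SetPtn d) (j k : Fin d) :
    sameBlock π j k ↔ π.part j = π.part k := by
  rw [← π.mem_part_iff_part_eq_part (Finset.mem_univ j) (Finset.mem_univ k),
    π.mem_part_iff_exists]
  rfl

theorem blockOf_eq_part {d : ℕ} (π : SetPtn d) (a : Fin d) : blockOf π a = π.part a := by
  ext k
  rw [π.mem_part_iff_part_eq_part (Finset.mem_univ k) (Finset.mem_univ a), blockOf,
    Finset.mem_filter, sameBlock_iff_part_eq, eq_comm]
  simp

theorem card_fibre_part {d : ℕ} (π : SetPtn d) {B : Finset (Fin d)} (hB : B ∈ π.parts) :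
    Nat.card {x // π.part x = B} = B.card := by
  rw [Nat.card_eq_fintype_card, Fintype.card_subtype]
  congr 1
  ext x
  simp [π.part_eq_iff_mem hB]

theorem fibrePoly_part {d : ℕ} (π : SetPtn d) (a : Fin d) :
    fibrePoly π.part =
      descPochhammer ℚ (ptype π a).2 * ((ptype π a).1.map (descPochhammer ℚ)).prod := by
  have hparts : fibrePoly π.part = ∏ B ∈ π.parts, descPochhammer ℚ B.card := by
    rw [fibrePoly, ← Finset.prod_subset (Finset.subset_univ π.parts)]
    · exact Finset.prod_congr rfl fun B hB => by rw [card_fibre_part π hB]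
    · intro B _ hB
      have : IsEmpty {x // π.part x = B} :=
        ⟨fun x => hB (x.2 ▸ π.part_mem.2 (Finset.mem_univ _))⟩
      simp
  have hmem : blockOf π a ∈ π.parts := by
    rw [blockOf_eq_part]
    exact π.part_mem.2 (Finset.mem_univ a)
  rw [hparts, ← Finset.mul_prod_erase _ _ hmem, ptype, Multiset.map_map]
  rfl

theorem ptype_snd {d : ℕ} (π : SetPtn d) (a : Fin d) :
    (ptype π a).2 = Nat.card {x // π.part x = π.part a} := by
  rw [card_fibre_part π (π.part_mem.2 (Finset.mem_univ a)), ← blockOf_eq_part]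
  rfl

theorem fibrePoly_part_congr {d : ℕ} {a : Fin d} {π₁ π₂ : SetPtn d}
    (h : ptype π₁ a = ptype π₂ a) : fibrePoly π₁.part = fibrePoly π₂.part := by
  rw [fibrePoly_part π₁ a, fibrePoly_part π₂ a, h]

theorem fibrePoly_isolateLabel_part_congr {d : ℕ} {a : Fin d} {π₁ π₂ : SetPtn d}
    (h : ptype π₁ a = ptype π₂ a) :
    fibrePoly (isolateLabel π₁.part a) = fibrePoly (isolateLabel π₂.part a) := by
  have h₁ := fibrePoly_isolateLabel π₁.part a
  have h₂ := fibrePoly_isolateLabel π₂.part a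
  rw [fibrePoly_part_congr h, ← h₂, ← ptype_snd, ← ptype_snd, h] at h₁
  exact mul_right_cancel₀ (Polynomial.X_sub_C_ne_zero _) h₁

/-- Passing from `π` to the partition with `a` split off its block costs at most a factor
`d / t` at `-t`. -/
theorem fibrePoly_part_le {d : ℕ} (π : SetPtn d) (a : Fin d) {t : ℚ} (ht : 0 < t) (ht1 : t ≤ 1) :
    t * ((-1) ^ d * (fibrePoly π.part).eval (-t)) ≤
      d * ((-1) ^ d * (fibrePoly (isolateLabel π.part a)).eval (-t)) := by
  have h := congrArg (Polynomial.eval (-t)) (fibrePoly_isolateLabel π.part a)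
  simp only [Polynomial.eval_mul, Polynomial.eval_sub, Polynomial.eval_X, Polynomial.eval_C] at h
  have hnonneg := fibrePoly_eval_neg_nonneg (isolateLabel π.part a) ht
  have hcard := Fintype.card_subtype_le (fun x => π.part x = π.part a)
  rw [← Nat.card_eq_fintype_card] at hcard
  rw [Fintype.card_fin] at hnonneg hcard
  have hcard' : (Nat.card {x // π.part x = π.part a} : ℚ) ≤ d := by exact_mod_cast hcard
  have h' : t * ((-1) ^ d * (fibrePoly π.part).eval (-t)) =
      (t + (Nat.card {x // π.part x = π.part a} - 1)) *
        ((-1) ^ d * (fibrePoly (isolateLabel π.part a)).eval (-t)) := by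
    linear_combination (-1) ^ d * h
  rw [h']
  exact mul_le_mul_of_nonneg_right (by linarith) hnonneg

/-- The sum of the values of `f` at all words in the letters `1, …, N`. -/
def wordSum (d N : ℕ) : Md d →ₗ[ℚ] ℚ :=
  ∑ κ : Fin d → Fin N, LinearMap.proj fun i => (κ i).1.succPNat

/-- The sum of the values of `f` at the words in the letters `1, …, N` in which the letter
at `a` has been replaced by the new letter `N + 1`. -/
def freshWordSum {d : ℕ} (a : Fin d) (N : ℕ) : Md d →ₗ[ℚ] ℚ :=
  ∑ κ : Fin d → Fin N, LinearMap.proj fun i => if i = a then N.succPNat else (κ i).1.succPNat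

theorem sum_ite_eq_natCard {α : Type} [Fintype α] (P Q : α → Prop) [DecidablePred P]
    (h : ∀ x, P x ↔ Q x) :
    (∑ x, if P x then (1 : ℚ) else 0) = Nat.card {x // Q x} := by
  rw [Finset.sum_boole, Nat.card_eq_fintype_card, Fintype.card_subtype]
  simp only [h]

theorem succPNat_ne_iff {N : ℕ} (x y : Fin N) : x.1.succPNat ≠ y.1.succPNat ↔ x ≠ y := by
  rw [Ne, Nat.succPNat_inj, Fin.val_inj]

theorem freshWord_ne_iff {d N : ℕ} {a j k : Fin d} (κ : Fin d → Fin N) (hjk : j ≠ k) :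
    ((if j = a then N.succPNat else (κ j).1.succPNat) ≠
      if k = a then N.succPNat else (κ k).1.succPNat) ↔ (j ≠ a → k ≠ a → κ j ≠ κ k) := by
  have hj := (κ j).2
  have hk := (κ k).2
  by_cases h₁ : j = a <;> by_cases h₂ : k = a
  · exact absurd (h₁.trans h₂.symm) hjk
  · simp [h₁, h₂, hk.ne']
  · simp [h₁, h₂, hj.ne]
  · simp only [h₁, h₂, if_false, succPNat_ne_iff, ne_eq, not_false_eq_true, forall_const]

theorem wordSum_YG {d : ℕ} (G : SimpleGraph (Fin d)) (N : ℕ) :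
    wordSum d N (YG G) = colouringCount G N := by
  rw [wordSum, LinearMap.sum_apply]
  simp only [LinearMap.coe_proj, Function.eval, YG]
  refine sum_ite_eq_natCard (α := Fin d → Fin N) _ _ fun κ =>
    forall₂_congr fun j k => forall_congr' fun _ => ?_
  exact succPNat_ne_iff _ _

theorem freshWordSum_YG {d : ℕ} (G : SimpleGraph (Fin d)) (a : Fin d) (N : ℕ) :
    freshWordSum a N (YG G) = colouringCount (isolateVertex G a) N := by
  rw [freshWordSum, LinearMap.sum_apply]
  simp only [LinearMap.coe_proj, Function.eval, YG]
  refine sum_ite_eq_natCard (α := Fin d → Fin N) _ _ fun κ => forall₂_congr fun j k => ?_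
  refine Iff.intro (fun h hjk => ?_) (fun h hjk => ?_)
  · exact (freshWord_ne_iff κ hjk.1.ne).1 (h hjk.1) hjk.2.1 hjk.2.2
  · exact (freshWord_ne_iff κ hjk.ne).2 fun hj hk => h ⟨hjk, hj, hk⟩

theorem wordSum_eSP {d : ℕ} (π : SetPtn d) (N : ℕ) :
    wordSum d N (eSP π) = (fibrePoly π.part).eval (N : ℚ) := by
  rw [wordSum, LinearMap.sum_apply, fibrePoly_eval_natCast]
  simp only [LinearMap.coe_proj, Function.eval, eSP]
  refine sum_ite_eq_natCard (α := Fin d → Fin N) _ _ fun κ =>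
    forall₂_congr fun j k => forall_congr' fun _ => ?_
  exact imp_congr (sameBlock_iff_part_eq π j k) (succPNat_ne_iff _ _)

theorem freshWordSum_eSP {d : ℕ} (π : SetPtn d) (a : Fin d) (N : ℕ) :
    freshWordSum a N (eSP π) = (fibrePoly (isolateLabel π.part a)).eval (N : ℚ) := by
  rw [freshWordSum, LinearMap.sum_apply, fibrePoly_eval_natCast]
  simp only [LinearMap.coe_proj, Function.eval, eSP]
  refine sum_ite_eq_natCard (α := Fin d → Fin N) _ _ fun κ =>
    forall₂_congr fun j k => forall_congr' fun hjk => ?_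
  refine (imp_congr (sameBlock_iff_part_eq π j k) (freshWord_ne_iff κ hjk)).trans ?_
  by_cases hj : j = a <;> by_cases hk : k = a
  · exact absurd (hj.trans hk.symm) hjk
  all_goals simp [isolateLabel, hj, hk]

/-- If a linear functional agrees on each `eSP π` with evaluation at `N` of a polynomial depending
only on the type of `π`, then an expansion modulo `Ksub a` is an identity of polynomials. -/
theorem eq_sum_smul_of_mem_Ksub {d : ℕ} {a : Fin d} (L : ℕ → Md d →ₗ[ℚ] ℚ)
    (P : SetPtn d → Polynomial ℚ) (hL : ∀ N π, L N (eSP π) = (P π).eval (N : ℚ))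
    (hP : ∀ π₁ π₂, ptype π₁ a = ptype π₂ a → P π₁ = P π₂) {f : Md d} {p : Polynomial ℚ}
    (hp : ∀ N : ℕ, p.eval (N : ℚ) = L N f) {s : Finset (SetPtn d)} {c : SetPtn d → ℚ}
    (hf : f - ∑ π ∈ s, c π • eSP π ∈ Ksub a) : p = ∑ π ∈ s, c π • P π := by
  have hN : ∀ N : ℕ, p.eval (N : ℚ) = (∑ π ∈ s, c π • P π).eval (N : ℚ) := fun N => by
    have hle : Ksub a ≤ LinearMap.ker (L N) := by
      refine Submodule.span_le.2 ?_
      rintro _ ⟨π₁, π₂, h, rfl⟩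
      simp [hL, hP _ _ h]
    have h := LinearMap.mem_ker.1 (hle hf)
    rw [map_sub, sub_eq_zero] at h
    rw [hp, h, Polynomial.eval_finsetSum, map_sum]
    simp [hL]
  refine Polynomial.eq_of_infinite_eval_eq _ _
    ((Set.infinite_range_of_injective (Nat.cast_injective (R := ℚ))).mono ?_)
  rintro _ ⟨N, rfl⟩
  exact hN N

theorem not_isEPosNCAt_of_cut {d : ℕ} (G : SimpleGraph (Fin d)) {v a b : Fin d} (ha : a ≠ v)
    (hb : b ≠ v) (hab : G.Reachable a b) (hcut : ¬ (isolateVertex G v).Reachable a b) :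
    ¬ IsEPosNCAt G v := by
  rintro ⟨s, c, hc, hmem⟩
  obtain ⟨p, hp, _, hpC⟩ := exists_chromaticPolynomial d (Fin d) (by simp) G
  obtain ⟨q, hq, C, hqC⟩ := exists_chromaticPolynomial d (Fin d) (by simp) (isolateVertex G v)
  have hp' := eq_sum_smul_of_mem_Ksub (wordSum d) (fun π => fibrePoly π.part)
    (fun N π => wordSum_eSP π N) (fun _ _ => fibrePoly_part_congr)
    (fun N => (hp N).trans (wordSum_YG G N).symm) hmem
  have hq' := eq_sum_smul_of_mem_Ksub (freshWordSum v) (fun π => fibrePoly (isolateLabel π.part v))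
    (fun N π => freshWordSum_eSP π v N) (fun _ _ => fibrePoly_isolateLabel_part_congr)
    (fun N => (hq N).trans (freshWordSum_YG G v N).symm) hmem
  have hpq : ∀ t : ℚ, 0 < t → t ≤ 1 →
      t * ((-1) ^ d * p.eval (-t)) ≤ d * ((-1) ^ d * q.eval (-t)) := fun t ht ht1 => by
    rw [hp', hq', Polynomial.eval_finsetSum, Polynomial.eval_finsetSum]
    simp only [Finset.mul_sum, Polynomial.eval_smul, smul_eq_mul]
    refine Finset.sum_le_sum fun π _ => ?_
    have := mul_le_mul_of_nonneg_left (fibrePoly_part_le π v ht ht1) (hc π)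
    linarith
  have hcomp := card_connectedComponent_isolateVertex G ha hb hab hcut
  set k := Nat.card G.ConnectedComponent
  have hbound : ∀ t : ℚ, 0 < t → t ≤ 1 → 1 ≤ d * C * t := fun t ht ht1 => by
    have hC : 0 ≤ C := by
      have := (hqC 1 one_pos le_rfl).1.trans (hqC 1 one_pos le_rfl).2
      simp only [one_pow, mul_one] at this
      linarith
    have hpow := pow_le_pow_of_le_one ht.le ht1 hcomp
    have h₁ := mul_le_mul_of_nonneg_left (hpC t ht ht1).1 ht.le
    have h₂ := (hqC t ht ht1).2.trans (mul_le_mul_of_nonneg_left hpow hC)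
    have h₃ := mul_le_mul_of_nonneg_left h₂ (Nat.cast_nonneg (α := ℚ) d)
    have h₄ : t ^ (k + 1) * 1 ≤ t ^ (k + 1) * (d * C * t) := by
      calc t ^ (k + 1) * 1 = t * t ^ k := by ring
        _ ≤ d * (C * t ^ (k + 2)) := h₁.trans ((hpq t ht ht1).trans h₃)
        _ = t ^ (k + 1) * (d * C * t) := by ring
    exact le_of_mul_le_mul_left h₄ (pow_pos ht _)
  have hone := hbound 1 one_pos le_rfl
  rw [mul_one] at hone
  have hpos : (0 : ℚ) < d * C := by linarith
  have hhalf := hbound (1 / (2 * (d * C))) (by positivity)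
    (by rw [div_le_one (by positivity)]; linarith)
  have : d * C * (1 / (2 * (d * C))) = 1 / 2 := by
    rw [mul_one_div, div_mul_cancel_right₀ hpos.ne', one_div]
  linarith

theorem reachable_induce_of_isolateVertex {V : Type} (G : SimpleGraph V) {v a b : V}
    (hab : (isolateVertex G v).Reachable a b) (ha : a ≠ v) (hb : b ≠ v) :
    (SimpleGraph.induce {x : V | x ≠ v} G).Reachable ⟨a, ha⟩ ⟨b, hb⟩ := by
  obtain ⟨w⟩ := hab
  induction w with
  | nil => rfl
  | @cons x y _ hadj _ ih =>
    refine SimpleGraph.Reachable.trans ?_ (ih hadj.2.2 hb)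
    exact SimpleGraph.Adj.reachable (SimpleGraph.induce_adj.2 hadj.1)

theorem stmt16 {V : Type} [Fintype V] [DecidableEq V] (G : SimpleGraph V)
    (d : ℕ) (hd : 0 < d) (hcard : Fintype.card V = d)
    (v a b : V) (ha : a ≠ v) (hb : b ≠ v)
    (hreach : G.Reachable a b)
    (hcut : ¬ (SimpleGraph.induce {x : V | x ≠ v} G).Reachable ⟨a, ha⟩ ⟨b, hb⟩) :
    ∀ φ : V ≃ Fin d, φ v = (⟨d - 1, by omega⟩ : Fin d) →
      ¬ IsEPosNCAt (SimpleGraph.comap φ.symm G) (⟨d - 1, by omega⟩ : Fin d) := by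
  intro φ hφ
  rw [← hφ]
  let e : SimpleGraph.comap φ.symm G ≃g G := SimpleGraph.Iso.comap φ.symm G
  let f : isolateVertex (SimpleGraph.comap φ.symm G) (φ v) →g isolateVertex G v :=
    { toFun := φ.symm
      map_rel' := fun h => ⟨h.1, fun h' => h.2.1 (φ.symm_apply_eq.1 h'),
        fun h' => h.2.2 (φ.symm_apply_eq.1 h')⟩ }
  refine not_isEPosNCAt_of_cut _ (φ.injective.ne ha) (φ.injective.ne hb) ?_ fun h => ?_
  · exact hreach.map e.symm.toHom
  · refine hcut (reachable_induce_of_isolateVertex G ?_ ha hb)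
    have hf : ∀ x, f (φ x) = x := φ.symm_apply_apply
    simpa only [hf] using h.map f
end
end
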